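/- Fix C ≥ 2 classes with means μ_1, …, μ_C ∈ ℝ^m, a common positive definite within-class covariance matrix Σ_c, and a real n×m matrix F of full row rank n; let μ̄ = (1/C)∑_c μ_c, Σ_F = (1/C)∑_c F(μ_c − μ̄)(μ_c − μ̄)ᵀFᵀ, and Σ_{F,c} = F Σ_c Fᵀ. Let the pair (a, b) be drawn with a and b independent and uniform on {1, …, C}, and, conditionally on (a, b), let X, Y_1^a, …, Y_k^a, Y_1^b, …, Y_k^b be independent multivariate Gaussians with X ~ N(μ_a, Σ_c), Y_i^a ~ N(μ_a, Σ_c), Y_i^b ~ N(μ_b, Σ_c); set Ȳ_a = (1/k)∑_i Y_i^a, Ȳ_b = (1/k)∑_i Y_i^b and α = ‖F X − F Ȳ_b‖² − ‖F X − F Ȳ_a‖². If Tr(Σ_F) > 0, then under the joint (mixture) distribution, P(α ≤ 0) ≤ 1 − 4·Tr(Σ_F)² / (8·(1 + 1/k)²·Tr(Σ_{F,c}²) + 16·(1 + 1/k)·Tr(Σ_F Σ_{F,c}) + E[((μ_a − μ_b)ᵀ Fᵀ F (μ_a − μ_b))²]), where the expectation in the last term is over the random pair (a, b). -/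

import Mathlib

open MeasureTheory ProbabilityTheory Matrix Real

/-- Density of the multivariate Gaussian distribution on ℝᵐ with mean `mv` and
covariance matrix `S`. -/
noncomputable def gaussPdf {m : ℕ} (mv : Fin m → ℝ) (S : Matrix (Fin m) (Fin m) ℝ)
    (x : Fin m → ℝ) : ℝ :=
  (Real.sqrt ((2 * Real.pi) ^ m * S.det))⁻¹
    * Real.exp (-(1 / 2) * ((x - mv) ⬝ᵥ S⁻¹.mulVec (x - mv)))

/-- The multivariate Gaussian measure on ℝᵐ with mean `mv` and covariance matrix `S`. -/
noncomputable def gaussMeasure {m : ℕ} (mv : Fin m → ℝ)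
    (S : Matrix (Fin m) (Fin m) ℝ) : Measure (Fin m → ℝ) :=
  volume.withDensity fun x => ENNReal.ofReal (gaussPdf mv S x)

/-- View a vector in `Fin n → ℝ` as an element of Euclidean space (with the L2 norm). -/
noncomputable def euclid {n : ℕ} (v : Fin n → ℝ) : EuclideanSpace ℝ (Fin n) :=
  (WithLp.equiv 2 (∀ _ : Fin n, ℝ)).symm v



section RiskHelpers
open scoped ENNReal MatrixOrder

lemma meas_coord {m : ℕ} (i : Fin m) : Measurable (fun x : Fin m → ℝ => x i) :=
  measurable_pi_apply i

lemma stdPi_eq (m : ℕ) :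
    Measure.pi (fun _ : Fin m => gaussianReal 0 1)
      = (volume : Measure (Fin m → ℝ)).withDensity
        (fun z => ENNReal.ofReal (∏ i, gaussianPDFReal 0 1 (z i))) := by
  refine Measure.pi_eq fun s hs => ?_
  rw [withDensity_apply _ (MeasurableSet.univ_pi hs), volume_pi, Measure.restrict_pi_pi]
  rw [← ofReal_integral_eq_lintegral_ofReal]
  · rw [integral_fintype_prod_eq_prod (fun _ => gaussianPDFReal 0 1),
      ENNReal.ofReal_prod_of_nonneg]
    · refine Finset.prod_congr rfl fun i _ => ?_
      rw [gaussianReal_apply_eq_integral _ one_ne_zero]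
    · intro i _
      exact integral_nonneg fun x => gaussianPDFReal_nonneg _ _ _
  · exact Integrable.fintype_prod fun i => (integrable_gaussianPDFReal 0 1).restrict
  · exact Filter.Eventually.of_forall fun z =>
      Finset.prod_nonneg fun i _ => gaussianPDFReal_nonneg _ _ _

lemma stdPdf_eq {m : ℕ} (mv : Fin m → ℝ) (S R : Matrix (Fin m) (Fin m) ℝ)
    (hRt : Rᵀ = R) (hRR : R * R = S) (hdet : R.det ≠ 0) (z : Fin m → ℝ) :
    (∏ i, gaussianPDFReal 0 1 (z i)) = |R.det| * gaussPdf mv S (R *ᵥ z + mv) := by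
  have hu : IsUnit R.det := isUnit_iff_ne_zero.2 hdet
  have hq : (R *ᵥ z) ⬝ᵥ S⁻¹ *ᵥ (R *ᵥ z) = ∑ i, z i ^ 2 := by
    rw [← hRR, Matrix.mul_inv_rev, mulVec_mulVec, mul_assoc, Matrix.nonsing_inv_mul _ hu,
      mul_one]
    nth_rw 1 [← hRt]
    rw [mulVec_transpose, ← dotProduct_mulVec, mulVec_mulVec, Matrix.mul_nonsing_inv _ hu,
      one_mulVec]
    simp [dotProduct, sq]
  have hs : √((2 * π) ^ m * S.det) = √((2 * π) ^ m) * |R.det| := by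
    rw [← hRR, det_mul, ← sq, Real.sqrt_mul (by positivity), Real.sqrt_sq_eq_abs]
  have h0 : |R.det| ≠ 0 := abs_ne_zero.2 hdet
  have hs2 : √((2 * π) ^ m) = √(2 * π) ^ m := by
    rw [Real.sqrt_eq_iff_mul_self_eq_of_pos (by positivity), ← mul_pow,
      Real.mul_self_sqrt (by positivity)]
  unfold gaussPdf
  rw [add_sub_cancel_right, hq, hs, hs2]
  simp only [gaussianPDFReal, Finset.prod_mul_distrib, ← Real.exp_sum]
  simp only [NNReal.coe_one, mul_one, sub_zero, Finset.prod_const, Finset.card_univ,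
    Fintype.card_fin, ← Finset.sum_div, Finset.sum_neg_distrib]
  rw [mul_inv, inv_pow]
  have : (-∑ i, z i ^ 2) / 2 = -(1 / 2) * ∑ i, z i ^ 2 := by ring
  rw [this]
  field_simp

lemma measurable_gaussPdf {m : ℕ} (mv : Fin m → ℝ) (S : Matrix (Fin m) (Fin m) ℝ) :
    Measurable (gaussPdf mv S) := by
  unfold gaussPdf
  apply Continuous.measurable
  fun_prop

lemma gaussMeasure_eq_map {m : ℕ} (mv : Fin m → ℝ) (S R : Matrix (Fin m) (Fin m) ℝ)
    (hRt : Rᵀ = R) (hRR : R * R = S) (hdet : R.det ≠ 0) :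
    gaussMeasure mv S
      = (Measure.pi (fun _ : Fin m => gaussianReal 0 1)).map (fun z => R *ᵥ z + mv) := by
  have hT : Measurable (fun z : Fin m → ℝ => R *ᵥ z + mv) := by
    apply Continuous.measurable; fun_prop
  have hL : Measurable (toLin' R) := by
    apply Continuous.measurable
    exact LinearMap.continuous_of_finiteDimensional _
  have hp := (measurable_gaussPdf mv S).ennreal_ofReal
  refine Measure.ext_of_lintegral _ fun g hg => ?_
  have hh : Measurable (fun x => ENNReal.ofReal (gaussPdf mv S x) * g x) := hp.mul hg
  have hstd : Measurable (fun z : Fin m → ℝ => ENNReal.ofReal (∏ i, gaussianPDFReal 0 1 (z i))) := by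
    apply Measurable.ennreal_ofReal
    exact Finset.measurable_prod _ fun i _ =>
      (measurable_gaussianPDFReal 0 1).comp (measurable_pi_apply i)
  rw [lintegral_map hg hT, stdPi_eq, gaussMeasure,
    lintegral_withDensity_eq_lintegral_mul _ hp hg,
    lintegral_withDensity_eq_lintegral_mul _ hstd
      (show Measurable (fun z => g (R *ᵥ z + mv)) from hg.comp hT)]
  simp only [Pi.mul_apply]
  have h1 : ∀ z : Fin m → ℝ, ENNReal.ofReal (∏ i, gaussianPDFReal 0 1 (z i)) * g (R *ᵥ z + mv)
      = ENNReal.ofReal |R.det| * (ENNReal.ofReal (gaussPdf mv S (toLin' R z + mv))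
        * g (toLin' R z + mv)) := by
    intro z
    rw [stdPdf_eq mv S R hRt hRR hdet, ENNReal.ofReal_mul (abs_nonneg _), mul_assoc,
      toLin'_apply]
  simp_rw [h1]
  have hh' : Measurable (fun x => ENNReal.ofReal (gaussPdf mv S (x + mv)) * g (x + mv)) :=
    hh.comp (measurable_add_const mv)
  rw [lintegral_const_mul _ (show Measurable (fun z => ENNReal.ofReal
      (gaussPdf mv S (toLin' R z + mv)) * g (toLin' R z + mv)) from hh'.comp hL),
    ← lintegral_map (f := fun x => ENNReal.ofReal (gaussPdf mv S (x + mv)) * g (x + mv)) hh' hL,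
    Real.map_matrix_volume_pi_eq_smul_volume_pi hdet, lintegral_smul_measure, smul_eq_mul,
    ← mul_assoc, ← ENNReal.ofReal_mul (abs_nonneg _), ← abs_mul, mul_inv_cancel₀ hdet]
  simp only [abs_one, ENNReal.ofReal_one, one_mul]
  exact (lintegral_add_right_eq_self
    (fun x => ENNReal.ofReal (gaussPdf mv S x) * g x) mv).symm

lemma gaussMeasure_eq_mvg {m : ℕ} (mv : Fin m → ℝ) (S : Matrix (Fin m) (Fin m) ℝ)
    (hS : S.PosDef) :
    gaussMeasure mv S = (multivariateGaussian (WithLp.toLp 2 mv) S).map WithLp.ofLp := by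
  have hRR : CFC.sqrt S * CFC.sqrt S = S := CFC.sqrt_mul_sqrt_self _ hS.posSemidef.nonneg
  have hRt : (CFC.sqrt S)ᵀ = CFC.sqrt S := by
    have := (CFC.sqrt_nonneg S).isSelfAdjoint
    rw [IsSelfAdjoint, star_eq_conjTranspose, conjTranspose_eq_transpose_of_trivial] at this
    exact this
  have hdet : (CFC.sqrt S).det ≠ 0 := by
    intro h
    have := hS.det_pos
    rw [← hRR, det_mul, h] at this
    simp at this
  rw [gaussMeasure_eq_map mv S _ hRt hRR hdet, multivariateGaussian, ← map_pi_eq_stdGaussian,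
    Measure.map_map, Measure.map_map]
  · congr 1
    ext z i
    simp [add_comm]
  all_goals fun_prop

lemma isGaussian_gaussMeasure {m : ℕ} (mv : Fin m → ℝ) (S : Matrix (Fin m) (Fin m) ℝ)
    (hS : S.PosDef) : IsGaussian (gaussMeasure mv S) := by
  rw [gaussMeasure_eq_mvg mv S hS]
  exact isGaussian_map_equiv (EuclideanSpace.equiv (Fin m) ℝ)

lemma integral_gaussMeasure {m : ℕ} (mv : Fin m → ℝ) (S : Matrix (Fin m) (Fin m) ℝ)
    (hS : S.PosDef) (i : Fin m) : ∫ x, x i ∂(gaussMeasure mv S) = mv i := by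
  rw [gaussMeasure_eq_mvg mv S hS, integral_map (by fun_prop)
    (meas_coord i).aestronglyMeasurable]
  have h := (EuclideanSpace.proj (𝕜 := ℝ) i).integral_comp_comm
    (IsGaussian.integrable_fun_id (μ := multivariateGaussian (WithLp.toLp 2 mv) S))
  simpa using h

lemma covariance_gaussMeasure {m : ℕ} (mv : Fin m → ℝ) (S : Matrix (Fin m) (Fin m) ℝ)
    (hS : S.PosDef) (i j : Fin m) :
    cov[fun x => x i, fun x => x j; gaussMeasure mv S] = S i j := by
  rw [gaussMeasure_eq_mvg mv S hS, covariance_map (meas_coord i).aestronglyMeasurable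
    (meas_coord j).aestronglyMeasurable (by fun_prop)]
  exact covariance_eval_multivariateGaussian hS.posSemidef i j


section PiGauss
variable {ι : Type*} [Fintype ι] {m n : ℕ}

/-- The linear statistic `F (∑ i, c i • w i)`, in coordinates. -/
noncomputable def linStat (F : Matrix (Fin n) (Fin m) ℝ) (c : ι → ℝ) (j : Fin n)
    (w : ι → Fin m → ℝ) : ℝ := ∑ q : ι × Fin m, (c q.1 * F j q.2) * w q.1 q.2

/-- `linStat` as a continuous linear map. -/
noncomputable def linStatL (F : Matrix (Fin n) (Fin m) ℝ) (c : ι → ℝ) :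
    (ι → Fin m → ℝ) →L[ℝ] (Fin n → ℝ) :=
  ContinuousLinearMap.pi fun j => ∑ q : ι × Fin m, (c q.1 * F j q.2) •
    ((ContinuousLinearMap.proj (R := ℝ) (φ := fun _ : Fin m => ℝ) q.2).comp
      (ContinuousLinearMap.proj (R := ℝ) (φ := fun _ : ι => Fin m → ℝ) q.1))

lemma linStatL_apply (F : Matrix (Fin n) (Fin m) ℝ) (c : ι → ℝ) (w : ι → Fin m → ℝ) (j : Fin n) :
    linStatL F c w j = linStat F c j w := by
  simp [linStatL, linStat]

lemma hasGaussianLaw_id_pi (ν : ι → Measure (Fin m → ℝ)) [∀ i, IsGaussian (ν i)] :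
    HasGaussianLaw (fun w : ι → Fin m → ℝ => w) (Measure.pi ν) := by
  have h := iIndepFun_pi (μ := ν) (X := fun _ => (id : (Fin m → ℝ) → (Fin m → ℝ))) (fun _ => aemeasurable_id)
  refine iIndepFun.hasGaussianLaw (X := fun i (w : ι → Fin m → ℝ) => w i) (fun i => ?_) h
  constructor
  have : IsGaussian (Measure.map (Function.eval i) (Measure.pi ν)) := by
    rw [(measurePreserving_eval ν i).map_eq]
    infer_instance
  exact this

lemma memLp_coord (ν : ι → Measure (Fin m → ℝ)) [∀ i, IsGaussian (ν i)] (i : ι) (p : Fin m) :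
    MemLp (fun w : ι → Fin m → ℝ => w i p) 2 (Measure.pi ν) :=
  ((hasGaussianLaw_id_pi ν).map_fun
    ((ContinuousLinearMap.proj (R := ℝ) (φ := fun _ : Fin m => ℝ) p).comp
      (ContinuousLinearMap.proj (R := ℝ) (φ := fun _ : ι => Fin m → ℝ) i))).memLp_two

lemma memLp_linStat (ν : ι → Measure (Fin m → ℝ)) [∀ i, IsGaussian (ν i)]
    (F : Matrix (Fin n) (Fin m) ℝ) (c : ι → ℝ) (j : Fin n) :
    MemLp (linStat F c j) 2 (Measure.pi ν) := by
  unfold linStat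
  exact memLp_finsetSum _ fun q _ => (memLp_coord ν q.1 q.2).const_mul _

lemma cov_coord [DecidableEq ι] (ν : ι → Measure (Fin m → ℝ)) [∀ i, IsGaussian (ν i)]
    (S : Matrix (Fin m) (Fin m) ℝ)
    (hcov : ∀ i p q, cov[fun x => x p, fun x => x q; ν i] = S p q) (i i' : ι) (p q : Fin m) :
    cov[fun w : ι → Fin m → ℝ => w i p, fun w => w i' q; Measure.pi ν]
      = if i = i' then S p q else 0 := by
  split_ifs with h
  · subst h
    rw [← hcov i p q, ← (measurePreserving_eval ν i).map_eq,
      covariance_map (meas_coord p).aestronglyMeasurable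
        (meas_coord q).aestronglyMeasurable (measurable_pi_apply i : Measurable (Function.eval i)).aemeasurable]
    rfl
  · have h1 := (iIndepFun_pi (μ := ν) (X := fun _ => (id : (Fin m → ℝ) → (Fin m → ℝ))) (fun _ => aemeasurable_id)).indepFun h
    exact (h1.comp (meas_coord p) (meas_coord q)).covariance_eq_zero
      (memLp_coord ν i p) (memLp_coord ν i' q)

lemma cov_linStat (ν : ι → Measure (Fin m → ℝ)) [∀ i, IsGaussian (ν i)]
    (S : Matrix (Fin m) (Fin m) ℝ)
    (hcov : ∀ i p q, cov[fun x => x p, fun x => x q; ν i] = S p q)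
    (F : Matrix (Fin n) (Fin m) ℝ) (c c' : ι → ℝ) (j l : Fin n) :
    cov[linStat F c j, linStat F c' l; Measure.pi ν]
      = (∑ i, c i * c' i) * (F * S * Fᵀ) j l := by
  classical
  unfold linStat
  rw [covariance_fun_sum_fun_sum
    (X := fun (q : ι × Fin m) (w : ι → Fin m → ℝ) => (c q.1 * F j q.2) * w q.1 q.2)
    (Y := fun (q : ι × Fin m) (w : ι → Fin m → ℝ) => (c' q.1 * F l q.2) * w q.1 q.2)
    (fun q => (memLp_coord ν q.1 q.2).const_mul _)
    (fun q => (memLp_coord ν q.1 q.2).const_mul _)]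
  simp_rw [covariance_const_mul_left, covariance_const_mul_right, cov_coord ν S hcov,
    Fintype.sum_prod_type]
  rw [Finset.sum_mul]
  refine Finset.sum_congr rfl fun i _ => ?_
  have h1 : ∀ p, ∑ i', ∑ q, c i * F j p * (c' i' * F l q * if i = i' then S p q else 0)
      = ∑ q, c i * F j p * (c' i * F l q * S p q) := by
    intro p
    rw [Finset.sum_comm]
    simp
  simp_rw [h1]
  simp only [Matrix.mul_apply, transpose_apply, Finset.sum_mul, Finset.mul_sum]
  rw [Finset.sum_comm]
  refine Finset.sum_congr rfl fun q _ => Finset.sum_congr rfl fun p _ => by ring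

lemma integral_linStat (ν : ι → Measure (Fin m → ℝ)) [∀ i, IsGaussian (ν i)]
    (M : ι → Fin m → ℝ) (hM : ∀ i p, ∫ x, x p ∂(ν i) = M i p)
    (F : Matrix (Fin n) (Fin m) ℝ) (c : ι → ℝ) (j : Fin n) :
    ∫ w, linStat F c j w ∂(Measure.pi ν) = linStat F c j M := by
  unfold linStat
  rw [integral_finsetSum]
  · refine Finset.sum_congr rfl fun q _ => ?_
    rw [integral_const_mul, ← hM]
    congr 1
    exact integral_comp_eval (μ := ν) (f := fun x => x q.2)
      (meas_coord q.2).aestronglyMeasurable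
  · intro q _
    exact ((memLp_coord ν q.1 q.2).integrable (by norm_num)).const_mul _

lemma indep_linStat (ν : ι → Measure (Fin m → ℝ)) [∀ i, IsGaussian (ν i)]
    (S : Matrix (Fin m) (Fin m) ℝ)
    (hcov : ∀ i p q, cov[fun x => x p, fun x => x q; ν i] = S p q)
    (F : Matrix (Fin n) (Fin m) ℝ) (c c' : ι → ℝ) (hcc : ∑ i, c i * c' i = 0) :
    IndepFun (fun w j => linStat F c j w) (fun w j => linStat F c' j w) (Measure.pi ν) := by
  refine HasGaussianLaw.indepFun_of_covariance_eval ?_ fun i j => ?_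
  · have := (hasGaussianLaw_id_pi ν).map_fun ((linStatL F c).prod (linStatL F c'))
    have he : (fun w => ((fun j => linStat F c j w), (fun j => linStat F c' j w)))
        = fun w => ((linStatL F c).prod (linStatL F c')) w := by
      funext w
      refine Prod.ext ?_ ?_
      · funext j
        exact (linStatL_apply F c w j).symm
      · funext j
        exact (linStatL_apply F c' w j).symm
    rw [← he] at this
    exact this
  · exact (cov_linStat ν S hcov F c c' i j).trans (by rw [hcc, zero_mul])

/-- First and second moments of the product of two uncorrelated linear statistics. -/
lemma moments_linStat (ν : ι → Measure (Fin m → ℝ)) [∀ i, IsGaussian (ν i)]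
    (S : Matrix (Fin m) (Fin m) ℝ)
    (hcov : ∀ i p q, cov[fun x => x p, fun x => x q; ν i] = S p q)
    (M : ι → Fin m → ℝ) (hM : ∀ i p, ∫ x, x p ∂(ν i) = M i p)
    (F : Matrix (Fin n) (Fin m) ℝ) (c c' : ι → ℝ) (hcc : ∑ i, c i * c' i = 0) :
    let h := fun w => ∑ j, linStat F c j w * linStat F c' j w
    Integrable h (Measure.pi ν) ∧ Integrable (fun w => h w ^ 2) (Measure.pi ν) ∧
    ∫ w, h w ∂(Measure.pi ν) = ∑ j, linStat F c j M * linStat F c' j M ∧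
    ∫ w, h w ^ 2 ∂(Measure.pi ν) = ∑ j, ∑ l,
      ((∑ i, c i * c i) * (F * S * Fᵀ) j l + linStat F c j M * linStat F c l M) *
      ((∑ i, c' i * c' i) * (F * S * Fᵀ) j l + linStat F c' j M * linStat F c' l M) := by
  intro h
  have hind := indep_linStat ν S hcov F c c' hcc
  have mA := memLp_linStat ν F c
  have mB := memLp_linStat ν F c'
  have hsec : ∀ (c : ι → ℝ) j l, ∫ w, linStat F c j w * linStat F c l w ∂(Measure.pi ν)
      = (∑ i, c i * c i) * (F * S * Fᵀ) j l + linStat F c j M * linStat F c l M := by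
    intro c j l
    have h1 := covariance_eq_sub (memLp_linStat ν F c j) (memLp_linStat ν F c l)
    rw [cov_linStat ν S hcov, integral_linStat ν M hM, integral_linStat ν M hM] at h1
    simp only [Pi.mul_apply] at h1
    linarith
  have hi1 : ∀ j, IndepFun (linStat F c j) (linStat F c' j) (Measure.pi ν) := fun j =>
    hind.comp (φ := fun v : Fin n → ℝ => v j) (ψ := fun v : Fin n → ℝ => v j)
       (meas_coord j) (meas_coord j)
  have hi2 : ∀ j l, IndepFun (fun w => linStat F c j w * linStat F c l w)
      (fun w => linStat F c' j w * linStat F c' l w) (Measure.pi ν) := fun j l =>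
    hind.comp (φ := fun v : Fin n → ℝ => v j * v l)
      (ψ := fun v : Fin n → ℝ => v j * v l)
      ((meas_coord j).mul (meas_coord l))
      ((meas_coord j).mul (meas_coord l))
  have iA : ∀ j l, Integrable (fun w => linStat F c j w * linStat F c l w) (Measure.pi ν) :=
    fun j l => (mA j).integrable_mul (mA l)
  have iB : ∀ j l, Integrable (fun w => linStat F c' j w * linStat F c' l w) (Measure.pi ν) :=
    fun j l => (mB j).integrable_mul (mB l)
  have iAB : ∀ j, Integrable (fun w => linStat F c j w * linStat F c' j w) (Measure.pi ν) :=
    fun j => (mA j).integrable_mul (mB j)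
  have i4 : ∀ j l, Integrable (fun w => (linStat F c j w * linStat F c l w) *
      (linStat F c' j w * linStat F c' l w)) (Measure.pi ν) :=
    fun j l => (hi2 j l).integrable_mul (iA j l) (iB j l)
  have hsq : (fun w => h w ^ 2) = fun w => ∑ j, ∑ l, (linStat F c j w * linStat F c l w) *
      (linStat F c' j w * linStat F c' l w) := by
    funext w
    simp only [h, sq, Finset.sum_mul_sum]
    refine Finset.sum_congr rfl fun j _ => Finset.sum_congr rfl fun l _ => by ring
  refine ⟨integrable_finsetSum _ fun j _ => iAB j, ?_, ?_, ?_⟩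
  · rw [hsq]
    exact integrable_finsetSum _ fun j _ => integrable_finsetSum _ fun l _ => i4 j l
  · simp only [h]
    rw [integral_finsetSum _ fun j _ => iAB j]
    refine Finset.sum_congr rfl fun j _ => ?_
    rw [(hi1 j).integral_fun_mul_eq_mul_integral (mA j).1 (mB j).1,
      integral_linStat ν M hM, integral_linStat ν M hM]
  · rw [hsq, integral_finsetSum _ fun j _ => integrable_finsetSum _ fun l _ => i4 j l]
    refine Finset.sum_congr rfl fun j _ => ?_
    rw [integral_finsetSum _ fun l _ => i4 j l]
    refine Finset.sum_congr rfl fun l _ => ?_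
    rw [(hi2 j l).integral_fun_mul_eq_mul_integral (iA j l).1 (iB j l).1, hsec, hsec]

end PiGauss


lemma second_moment_bound {Ω : Type*} [MeasurableSpace Ω] (P : Measure Ω) [IsProbabilityMeasure P]
    (f : Ω → ℝ) (hf : Integrable f P) (hf2 : Integrable (fun ω => f ω ^ 2) P) (e D : ℝ)
    (he : ∫ ω, f ω ∂P = e) (hD : ∫ ω, f ω ^ 2 ∂P ≤ D) (hpos : 0 < e) :
    (P {ω | f ω ≤ 0}).toReal ≤ 1 - e ^ 2 / D := by
  have key : ∀ c : ℝ, ∫ ω, (1 - c * f ω) ^ 2 ∂P = 1 - 2 * c * e + c ^ 2 * ∫ ω, f ω ^ 2 ∂P := by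
    intro c
    have h1 : (fun ω => (1 - c * f ω) ^ 2) = fun ω => (1 - 2 * c * f ω) + c ^ 2 * f ω ^ 2 := by
      funext ω; ring
    have i1 : Integrable (fun ω => 1 - 2 * c * f ω) P := (integrable_const _).sub (hf.const_mul _)
    rw [h1, integral_add i1 (hf2.const_mul _),
      integral_sub (integrable_const _) (hf.const_mul _), integral_const_mul, integral_const_mul,
      he]
    simp
  have keyi : ∀ c : ℝ, Integrable (fun ω => (1 - c * f ω) ^ 2) P := by
    intro c
    have h1 : (fun ω => (1 - c * f ω) ^ 2) = fun ω => (1 - 2 * c * f ω) + c ^ 2 * f ω ^ 2 := by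
      funext ω; ring
    rw [h1]
    exact ((integrable_const _).sub (hf.const_mul _)).add (hf2.const_mul _)
  have hDpos : 0 < D := by
    refine lt_of_lt_of_le ?_ hD
    have h0 : 0 ≤ ∫ ω, f ω ^ 2 ∂P := integral_nonneg fun ω => sq_nonneg _
    rcases h0.lt_or_eq with h | h
    · exact h
    · exfalso
      have h2 : 0 ≤ ∫ ω, (1 - (1 / e) * f ω) ^ 2 ∂P := integral_nonneg fun ω => sq_nonneg _
      rw [key, ← h] at h2
      have : 2 * (1 / e) * e = 2 := by field_simp
      rw [this] at h2
      norm_num at h2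
  have hms : NullMeasurableSet {ω | f ω ≤ 0} P :=
    nullMeasurableSet_le hf.1.aemeasurable aemeasurable_const
  have h3 : (P {ω | f ω ≤ 0}).toReal ≤ ∫ ω, (1 - (e / D) * f ω) ^ 2 ∂P := by
    have h4 : ∫ ω, Set.indicator {ω | f ω ≤ 0} (fun _ => (1 : ℝ)) ω ∂P
        = (P {ω | f ω ≤ 0}).toReal := by
      rw [integral_indicator₀ hms]
      simp [Measure.real]
    rw [← h4]
    refine integral_mono ((integrable_const _).indicator₀ hms) (keyi _) fun ω => ?_
    by_cases h : f ω ≤ 0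
    · have h5 : 0 ≤ (e / D) * (-f ω) := mul_nonneg (by positivity) (by linarith)
      simp only [Set.indicator, Set.mem_ofPred_eq, h, if_true]
      nlinarith
    · simp only [Set.indicator, Set.mem_ofPred_eq, h, if_false]
      positivity
  rw [key] at h3
  have h6 : (e / D) ^ 2 * ∫ ω, f ω ^ 2 ∂P ≤ (e / D) ^ 2 * D := by gcongr
  have h7 : 2 * (e / D) * e = 2 * (e ^ 2 / D) := by ring
  have h8 : (e / D) ^ 2 * D = e ^ 2 / D := by field_simp
  linarith

lemma linStat_eq {ι : Type*} [Fintype ι] {m n : ℕ} (F : Matrix (Fin n) (Fin m) ℝ) (c : ι → ℝ)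
    (j : Fin n) (w : ι → Fin m → ℝ) : linStat F c j w = (F *ᵥ (∑ i, c i • w i)) j := by
  simp only [linStat, mulVec, dotProduct, Fintype.sum_prod_type, Finset.sum_apply, Pi.smul_apply,
    smul_eq_mul, Finset.mul_sum]
  rw [Finset.sum_comm]
  refine Finset.sum_congr rfl fun q _ => Finset.sum_congr rfl fun p _ => by ring

/-- Weights of `Ȳa - Ȳb`. -/
noncomputable def wA (k : ℕ) : Unit ⊕ (Fin k ⊕ Fin k) → ℝ :=
  Sum.elim (fun _ => 0) (Sum.elim (fun _ => 1 / (k : ℝ)) (fun _ => -(1 / (k : ℝ))))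

/-- Weights of `2 X - Ȳa - Ȳb`. -/
noncomputable def wB (k : ℕ) : Unit ⊕ (Fin k ⊕ Fin k) → ℝ :=
  Sum.elim (fun _ => 2) (Sum.elim (fun _ => -(1 / (k : ℝ))) (fun _ => -(1 / (k : ℝ))))

lemma wAA {k : ℕ} (hk : 0 < k) : ∑ i, wA k i * wA k i = 2 / k := by
  have : (k : ℝ) ≠ 0 := by positivity
  simp [wA]
  field_simp
  norm_num

lemma wBB {k : ℕ} (hk : 0 < k) : ∑ i, wB k i * wB k i = 4 + 2 / k := by
  have : (k : ℝ) ≠ 0 := by positivity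
  simp [wB]
  field_simp
  ring

lemma wAB {k : ℕ} : ∑ i, wA k i * wB k i = 0 := by
  simp [wA, wB]

lemma wA_apply {k m n : ℕ} (F : Matrix (Fin n) (Fin m) ℝ) (x : Fin m → ℝ)
    (ya yb : Fin k → Fin m → ℝ) (j : Fin n) :
    linStat F (wA k) j (Sum.elim (fun _ : Unit => x) (Sum.elim ya yb))
      = (F *ᵥ ((1 / (k : ℝ)) • ∑ i, ya i)) j - (F *ᵥ ((1 / (k : ℝ)) • ∑ i, yb i)) j := by
  rw [linStat_eq, ← Pi.sub_apply, ← mulVec_sub]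
  congr 2
  simp [wA, Finset.smul_sum, sub_eq_add_neg]

lemma wB_apply {k m n : ℕ} (F : Matrix (Fin n) (Fin m) ℝ) (x : Fin m → ℝ)
    (ya yb : Fin k → Fin m → ℝ) (j : Fin n) :
    linStat F (wB k) j (Sum.elim (fun _ : Unit => x) (Sum.elim ya yb))
      = 2 * (F *ᵥ x) j - (F *ᵥ ((1 / (k : ℝ)) • ∑ i, ya i)) j
        - (F *ᵥ ((1 / (k : ℝ)) • ∑ i, yb i)) j := by
  have : (2 * (F *ᵥ x) j : ℝ) = (F *ᵥ ((2 : ℝ) • x)) j := by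
    rw [mulVec_smul]; simp
  rw [this, linStat_eq, ← Pi.sub_apply, ← Pi.sub_apply, ← mulVec_sub, ← mulVec_sub]
  congr 2
  simp [wB, Finset.smul_sum, sub_eq_add_neg, add_assoc]
  exact add_comm _ _

lemma alpha_eq {k m n : ℕ} (F : Matrix (Fin n) (Fin m) ℝ) (x : Fin m → ℝ)
    (ya yb : Fin k → Fin m → ℝ) :
    ‖euclid (F.mulVec x - F.mulVec ((1 / (k : ℝ)) • ∑ i, yb i))‖ ^ 2
      - ‖euclid (F.mulVec x - F.mulVec ((1 / (k : ℝ)) • ∑ i, ya i))‖ ^ 2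
    = ∑ j, linStat F (wA k) j (Sum.elim (fun _ : Unit => x) (Sum.elim ya yb))
        * linStat F (wB k) j (Sum.elim (fun _ : Unit => x) (Sum.elim ya yb)) := by
  simp_rw [wA_apply, wB_apply, EuclideanSpace.real_norm_sq_eq]
  rw [← Finset.sum_sub_distrib]
  refine Finset.sum_congr rfl fun j _ => ?_
  change ((F *ᵥ x) j - (F *ᵥ ((1 / (k : ℝ)) • ∑ i, yb i)) j) ^ 2
    - ((F *ᵥ x) j - (F *ᵥ ((1 / (k : ℝ)) • ∑ i, ya i)) j) ^ 2 = _
  ring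

lemma mean_avg {k m : ℕ} (hk : 0 < k) (x : Fin m → ℝ) :
    (1 / (k : ℝ)) • ∑ _i : Fin k, x = x := by
  have : (k : ℝ) ≠ 0 := by positivity
  ext p
  simp
  field_simp

/-- Moments of the score under one conditional law. -/
lemma cond_moments {k m n : ℕ} (hk : 0 < k) (u v : Fin m → ℝ) (S : Matrix (Fin m) (Fin m) ℝ)
    (hS : S.PosDef) (F : Matrix (Fin n) (Fin m) ℝ) (G : Matrix (Fin n) (Fin n) ℝ)
    (hG : G = F * S * Fᵀ) (d : Fin n → ℝ) (hd : d = F *ᵥ u - F *ᵥ v) :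
    let Q := Measure.pi (Sum.elim (fun _ : Unit => gaussMeasure u S)
          (Sum.elim (fun _ : Fin k => gaussMeasure u S) (fun _ : Fin k => gaussMeasure v S)))
    let h := fun w => ∑ j, linStat F (wA k) j w * linStat F (wB k) j w
    Integrable h Q ∧ Integrable (fun w => h w ^ 2) Q ∧
    ∫ w, h w ∂Q = d ⬝ᵥ d ∧
    ∫ w, h w ^ 2 ∂Q = (2 / k) * (4 + 2 / k) * (∑ j, ∑ l, G j l ^ 2)
      + (4 + 4 / k) * (d ⬝ᵥ G *ᵥ d) + (d ⬝ᵥ d) ^ 2 := by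
  intro Q h
  let ν : Unit ⊕ (Fin k ⊕ Fin k) → Measure (Fin m → ℝ) :=
    Sum.elim (fun _ : Unit => gaussMeasure u S)
          (Sum.elim (fun _ : Fin k => gaussMeasure u S) (fun _ : Fin k => gaussMeasure v S))
  let M : Unit ⊕ (Fin k ⊕ Fin k) → (Fin m → ℝ) :=
    Sum.elim (fun _ : Unit => u) (Sum.elim (fun _ : Fin k => u) (fun _ : Fin k => v))
  have hν : ∀ i, ν i = gaussMeasure (M i) S := by
    rintro (i | i | i) <;> rfl
  have : ∀ i, IsGaussian (ν i) := fun i => by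
    rw [hν]; exact isGaussian_gaussMeasure _ _ hS
  obtain ⟨h1, h2, h3, h4⟩ := moments_linStat ν S
    (fun i p q => by rw [hν]; exact covariance_gaussMeasure _ _ hS p q) M
    (fun i p => by rw [hν]; exact integral_gaussMeasure _ _ hS p) F (wA k) (wB k) wAB
  have hA : ∀ j, linStat F (wA k) j M = d j := by
    intro j
    simp only [M, wA_apply, mean_avg hk, hd, Pi.sub_apply]
  have hB : ∀ j, linStat F (wB k) j M = d j := by
    intro j
    simp only [M, wB_apply, mean_avg hk, hd, Pi.sub_apply]
    ring
  refine ⟨h1, h2, h3.trans ?_, h4.trans ?_⟩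
  · simp only [hA, hB, dotProduct]
  · simp only [hA, hB, wAA hk, wBB hk, ← hG]
    have e1 : (d ⬝ᵥ d) ^ 2 = ∑ j, ∑ l, (d j * d l) * (d j * d l) := by
      simp only [dotProduct, sq, Finset.sum_mul_sum]
      refine Finset.sum_congr rfl fun j _ => Finset.sum_congr rfl fun l _ => by ring
    have e2 : d ⬝ᵥ G *ᵥ d = ∑ j, ∑ l, G j l * (d j * d l) := by
      simp only [dotProduct, mulVec, Finset.mul_sum]
      refine Finset.sum_congr rfl fun j _ => Finset.sum_congr rfl fun l _ => by ring
    rw [e1, e2]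
    simp only [Finset.mul_sum, ← Finset.sum_add_distrib]
    refine Finset.sum_congr rfl fun j _ => Finset.sum_congr rfl fun l _ => by ring

lemma pair_sum {C n : ℕ} (V : Fin C → Fin n → ℝ) (hV : ∑ c, V c = 0)
    (G : Matrix (Fin n) (Fin n) ℝ) :
    ∑ x : Fin C × Fin C, (V x.1 - V x.2) ⬝ᵥ G *ᵥ (V x.1 - V x.2)
      = 2 * C * ∑ c, V c ⬝ᵥ G *ᵥ V c := by
  rw [Fintype.sum_prod_type]
  simp only [mulVec_sub, dotProduct_sub, sub_dotProduct, Finset.sum_sub_distrib]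
  have h1 : ∑ s, ∑ t, V t ⬝ᵥ G *ᵥ V s = 0 := by
    simp_rw [← sum_dotProduct, hV]
    simp
  have h2 : ∑ s, ∑ t, V s ⬝ᵥ G *ᵥ V t = 0 := by
    rw [Finset.sum_comm]; exact h1
  rw [h1, h2]
  simp
  rw [← Finset.mul_sum]
  ring

lemma trace_SF {C n : ℕ} (V : Fin C → Fin n → ℝ) (G : Matrix (Fin n) (Fin n) ℝ) :
    (((1 / (C : ℝ)) • ∑ c, vecMulVec (V c) (V c)) * G).trace
      = (1 / (C : ℝ)) * ∑ c, V c ⬝ᵥ G *ᵥ V c := by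
  rw [smul_mul_assoc, trace_smul, Finset.sum_mul, trace_sum, smul_eq_mul]
  congr 1
  refine Finset.sum_congr rfl fun c _ => ?_
  rw [vecMulVec_mul, trace_vecMulVec, dotProduct_comm, ← dotProduct_mulVec]

lemma mixture {C : ℕ} {Ω : Type*} [MeasurableSpace Ω] (P : Measure Ω) [IsProbabilityMeasure P]
    (a b : Ω → Fin C) (hma : Measurable a) (hmb : Measurable b)
    (hunif : ∀ s t : Fin C, P {ω | a ω = s ∧ b ω = t} = ((C : ENNReal) ^ 2)⁻¹)
    {E : Type*} [MeasurableSpace E] (T : Ω → E) (hT : AEMeasurable T P)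
    (Q : Fin C → Fin C → Measure E)
    (hQ : ∀ s t, Measure.map T (ProbabilityTheory.cond P {ω | a ω = s ∧ b ω = t}) = Q s t)
    (f : E → ℝ) (hf : ∀ s t, Integrable f (Q s t)) :
    Integrable (fun ω => f (T ω)) P ∧
    ∫ ω, f (T ω) ∂P = ∑ x : Fin C × Fin C, 1 / (C : ℝ) ^ 2 * ∫ w, f w ∂(Q x.1 x.2) := by
  have hset : ∀ x : Fin C × Fin C, (fun ω => (a ω, b ω)) ⁻¹' {x} = {ω | a ω = x.1 ∧ b ω = x.2} := by
    intro x; ext ω; simp [Prod.ext_iff]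
  have hdec := sum_meas_smul_cond_fiber (X := fun ω => (a ω, b ω)) (hma.prodMk hmb) P
  simp only [hset, hunif] at hdec
  have hTc : ∀ x : Fin C × Fin C,
      AEMeasurable T (ProbabilityTheory.cond P {ω | a ω = x.1 ∧ b ω = x.2}) := fun x =>
    hT.mono_ac cond_absolutelyContinuous
  have hi : ∀ x : Fin C × Fin C, Integrable (fun ω => f (T ω))
      (ProbabilityTheory.cond P {ω | a ω = x.1 ∧ b ω = x.2}) := fun x => by
    have := hf x.1 x.2
    rw [← hQ] at this
    exact this.comp_aemeasurable (hTc x)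
  have hC : ∀ _ : Fin C × Fin C, ((C : ENNReal) ^ 2)⁻¹ ≠ ⊤ := fun x => by
    have : C ≠ 0 := fun h => by subst h; exact x.1.elim0
    simpa using this
  have hi' : ∀ x : Fin C × Fin C, Integrable (fun ω => f (T ω))
      (((C : ENNReal) ^ 2)⁻¹ • ProbabilityTheory.cond P {ω | a ω = x.1 ∧ b ω = x.2}) := fun x =>
    (hi x).smul_measure (hC x)
  constructor
  · rw [← hdec]
    exact integrable_finsetSum_measure.2 fun x _ => hi' x
  · have h0 : ∫ ω, f (T ω) ∂P = ∫ ω, f (T ω) ∂(∑ x : Fin C × Fin C,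
        ((C : ENNReal) ^ 2)⁻¹ • ProbabilityTheory.cond P {ω | a ω = x.1 ∧ b ω = x.2}) := by
      rw [hdec]
    rw [h0, integral_finsetSum_measure fun x _ => hi' x]
    refine Finset.sum_congr rfl fun x _ => ?_
    have h1 : AEStronglyMeasurable f
        (Measure.map T (ProbabilityTheory.cond P {ω | a ω = x.1 ∧ b ω = x.2})) := by
      rw [hQ]; exact (hf x.1 x.2).1
    rw [integral_smul_measure, ← hQ, integral_map (hTc x) h1]
    simp

lemma mixture_fin {C : ℕ} {Ω : Type*} [MeasurableSpace Ω] (P : Measure Ω) [IsProbabilityMeasure P]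
    (a b : Ω → Fin C) (hma : Measurable a) (hmb : Measurable b)
    (hunif : ∀ s t : Fin C, P {ω | a ω = s ∧ b ω = t} = ((C : ENNReal) ^ 2)⁻¹)
    (g : Fin C × Fin C → ℝ) :
    ∫ ω, g (a ω, b ω) ∂P = ∑ x : Fin C × Fin C, 1 / (C : ℝ) ^ 2 * g x := by
  have hm : Measurable fun ω => (a ω, b ω) := hma.prodMk hmb
  have : IsProbabilityMeasure (P.map fun ω => (a ω, b ω)) :=
    Measure.isProbabilityMeasure_map hm.aemeasurable
  rw [← integral_map (φ := fun ω => (a ω, b ω)) (f := g) hm.aemeasurable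
    (measurable_of_finite g).aestronglyMeasurable, integral_fintype (Integrable.of_finite)]
  refine Finset.sum_congr rfl fun x _ => ?_
  rw [Measure.real, Measure.map_apply hm (measurableSet_singleton x)]
  have hset : (fun ω => (a ω, b ω)) ⁻¹' {x} = {ω | a ω = x.1 ∧ b ω = x.2} := by
    ext ω; simp [Prod.ext_iff]
  rw [hset, hunif]
  simp

lemma mean_sum_aux (C : ℕ) (hC : (C : ℝ) ≠ 0) {m : ℕ} (x : Fin m → ℝ) :
    ∑ _i : Fin C, (1 / (C : ℝ)) • x = x := by
  ext p
  simp
  field_simp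

end RiskHelpers


/-- Finite-class instantiation of Theorem 1 (expected risk bound with LFDA) for k-shot
binary episodes: the class pair `(a, b)` is uniform on `Fin C × Fin C`, and conditionally
on `(a, b)` the query `X` and the support vectors `Yaᵢ, Ybᵢ` are independent Gaussians
with means `μ_a, μ_b` and common within-class covariance `Sc`.  If `Tr(Σ_F) > 0`, then
`P(α ≤ 0) ≤ 1 − 4·Tr(Σ_F)² / (8(1+1/k)²·Tr(Σ_{F,c}²) + 16(1+1/k)·Tr(Σ_F Σ_{F,c})
+ E[((μ_a − μ_b)ᵀ Fᵀ F (μ_a − μ_b))²])`. -/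
theorem expected_risk_bound_uniform_classes {C n m k : ℕ} (hC : 2 ≤ C) (hk : 0 < k)
    {Ω : Type*} [MeasurableSpace Ω] (P : Measure Ω) [IsProbabilityMeasure P]
    (a b : Ω → Fin C) (hma : Measurable a) (hmb : Measurable b)
    (X : Ω → (Fin m → ℝ)) (Ya Yb : Fin k → Ω → (Fin m → ℝ))
    (hmX : AEMeasurable X P) (hmYa : ∀ i, AEMeasurable (Ya i) P)
    (hmYb : ∀ i, AEMeasurable (Yb i) P)
    (mv : Fin C → (Fin m → ℝ)) (Sc : Matrix (Fin m) (Fin m) ℝ) (hSc : Sc.PosDef)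
    (F : Matrix (Fin n) (Fin m) ℝ) (hF : F.rank = n)
    -- `a` and `b` are independent and uniform on `{1, …, C}`:
    (hunif : ∀ s t : Fin C, P {ω | a ω = s ∧ b ω = t} = ((C : ENNReal) ^ 2)⁻¹)
    -- conditionally on `(a, b) = (s, t)`, the vector `(X, Ya, Yb)` consists of
    -- independent Gaussians `X ~ N(μ_s, Sc)`, `Yaᵢ ~ N(μ_s, Sc)`, `Ybᵢ ~ N(μ_t, Sc)`:
    (hcond : ∀ s t : Fin C,
      Measure.map
        (fun ω => (Sum.elim (fun _ : Unit => X ω)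
          (Sum.elim (fun i => Ya i ω) (fun i => Yb i ω)) :
            (Unit ⊕ (Fin k ⊕ Fin k)) → (Fin m → ℝ)))
        (ProbabilityTheory.cond P {ω | a ω = s ∧ b ω = t})
      = Measure.pi (Sum.elim (fun _ : Unit => gaussMeasure (mv s) Sc)
          (Sum.elim (fun _ : Fin k => gaussMeasure (mv s) Sc)
            (fun _ : Fin k => gaussMeasure (mv t) Sc))))
    (mubar : Fin m → ℝ) (hmubar : mubar = (1 / (C : ℝ)) • ∑ c, mv c)
    (SF : Matrix (Fin n) (Fin n) ℝ)
    (hSF : SF = (1 / (C : ℝ)) • ∑ c, vecMulVec (F.mulVec (mv c - mubar))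
      (F.mulVec (mv c - mubar)))
    (SFc : Matrix (Fin n) (Fin n) ℝ) (hSFc : SFc = F * Sc * Fᵀ)
    (α : Ω → ℝ)
    (hα : α = fun ω =>
      ‖euclid (F.mulVec (X ω) - F.mulVec ((1 / (k : ℝ)) • ∑ i, Yb i ω))‖ ^ 2
      - ‖euclid (F.mulVec (X ω) - F.mulVec ((1 / (k : ℝ)) • ∑ i, Ya i ω))‖ ^ 2)
    (hTr : 0 < SF.trace) :
    (P {ω | α ω ≤ 0}).toReal
      ≤ 1 - 4 * SF.trace ^ 2
          / (8 * (1 + 1 / (k : ℝ)) ^ 2 * (SFc ^ 2).trace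
            + 16 * (1 + 1 / (k : ℝ)) * (SF * SFc).trace
            + ∫ ω, ((mv (a ω) - mv (b ω)) ⬝ᵥ (Fᵀ * F).mulVec (mv (a ω) - mv (b ω))) ^ 2 ∂P) := by
  have hC0 : (C : ℝ) ≠ 0 := by positivity
  have hk0 : (0 : ℝ) < k := by positivity
  let T : Ω → (Unit ⊕ (Fin k ⊕ Fin k)) → (Fin m → ℝ) := fun ω =>
    Sum.elim (fun _ : Unit => X ω) (Sum.elim (fun i => Ya i ω) (fun i => Yb i ω))
  have hT : AEMeasurable T P := by
    refine aemeasurable_pi_lambda _ ?_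
    rintro (i | i | i)
    · exact hmX
    · exact hmYa i
    · exact hmYb i
  let h : ((Unit ⊕ (Fin k ⊕ Fin k)) → (Fin m → ℝ)) → ℝ :=
    fun w => ∑ j, linStat F (wA k) j w * linStat F (wB k) j w
  have hαT : α = fun ω => h (T ω) := by
    rw [hα]; funext ω; exact alpha_eq F (X ω) (fun i => Ya i ω) (fun i => Yb i ω)
  let V : Fin C → Fin n → ℝ := fun c => F.mulVec (mv c - mubar)
  have hV : ∑ c, V c = 0 := by
    simp only [V]
    rw [← mulVec_sum, Finset.sum_sub_distrib, hmubar]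
    have : ∑ c, mv c - ∑ _i : Fin C, (1 / (C : ℝ)) • ∑ c, mv c = 0 := by
      rw [mean_sum_aux C hC0, sub_self]
    rw [this, mulVec_zero]
  have hd : ∀ s t, V s - V t = F *ᵥ mv s - F *ᵥ mv t := by
    intro s t
    simp only [V, mulVec_sub]
    abel
  have hcm := fun s t => cond_moments hk (mv s) (mv t) Sc hSc F SFc hSFc (V s - V t) (hd s t)
  have M1 := mixture P a b hma hmb hunif T hT _ hcond h (fun s t => (hcm s t).1)
  have M2 := mixture P a b hma hmb hunif T hT _ hcond (fun w => h w ^ 2) (fun s t => (hcm s t).2.1)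
  have hl : ∫ ω, ((mv (a ω) - mv (b ω)) ⬝ᵥ (Fᵀ * F).mulVec (mv (a ω) - mv (b ω))) ^ 2 ∂P
      = ∑ x : Fin C × Fin C, 1 / (C : ℝ) ^ 2 * ((V x.1 - V x.2) ⬝ᵥ (V x.1 - V x.2)) ^ 2 := by
    rw [mixture_fin P a b hma hmb hunif (fun x =>
      ((mv x.1 - mv x.2) ⬝ᵥ (Fᵀ * F).mulVec (mv x.1 - mv x.2)) ^ 2)]
    refine Finset.sum_congr rfl fun x _ => ?_
    rw [hd, ← mulVec_sub, ← mulVec_mulVec, dotProduct_mulVec, vecMul_transpose]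
  have htr : ∀ G : Matrix (Fin n) (Fin n) ℝ, ∑ x : Fin C × Fin C,
      1 / (C : ℝ) ^ 2 * ((V x.1 - V x.2) ⬝ᵥ G *ᵥ (V x.1 - V x.2)) = 2 * (SF * G).trace := by
    intro G
    rw [← Finset.mul_sum, pair_sum V hV, hSF, trace_SF V G]
    field_simp
  have htr1 : ∑ x : Fin C × Fin C,
      1 / (C : ℝ) ^ 2 * ((V x.1 - V x.2) ⬝ᵥ (V x.1 - V x.2)) = 2 * SF.trace := by
    simpa using htr 1
  have hsum : ∑ j, ∑ l, SFc j l ^ 2 = (SFc ^ 2).trace := by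
    have hsym : SFcᵀ = SFc := by
      have := hSc.isHermitian.eq
      rw [conjTranspose_eq_transpose_of_trivial] at this
      rw [hSFc, transpose_mul, transpose_mul, transpose_transpose, this, Matrix.mul_assoc]
    rw [sq, trace]
    refine Finset.sum_congr rfl fun j _ => ?_
    rw [diag_apply, mul_apply]
    refine Finset.sum_congr rfl fun l _ => ?_
    rw [sq]
    congr 1
    exact congrFun (congrFun hsym.symm j) l
  have hnn2 : 0 ≤ (SFc ^ 2).trace := by
    rw [← hsum]; positivity
  have hnn1 : 0 ≤ (SF * SFc).trace := by
    rw [hSF, trace_SF V SFc]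
    refine mul_nonneg (by positivity) (Finset.sum_nonneg fun c _ => ?_)
    have := hSc.posSemidef.dotProduct_mulVec_nonneg (Fᵀ *ᵥ V c)
    rw [hSFc, ← mulVec_mulVec, ← mulVec_mulVec, dotProduct_mulVec, ← mulVec_transpose]
    simpa using this
  have hE1 : ∫ ω, h (T ω) ∂P = 2 * SF.trace := by
    rw [M1.2, ← htr1]
    exact Finset.sum_congr rfl fun x _ => by rw [(hcm x.1 x.2).2.2.1]
  have hE2 : ∫ ω, h (T ω) ^ 2 ∂P = (2 / k) * (4 + 2 / k) * (SFc ^ 2).trace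
      + (4 + 4 / k) * (2 * (SF * SFc).trace)
      + ∑ x : Fin C × Fin C, 1 / (C : ℝ) ^ 2 * ((V x.1 - V x.2) ⬝ᵥ (V x.1 - V x.2)) ^ 2 := by
    rw [M2.2, ← htr, Finset.mul_sum, ← hsum]
    have hcst : (2 / k : ℝ) * (4 + 2 / k) * ∑ j, ∑ l, SFc j l ^ 2
        = ∑ _x : Fin C × Fin C, 1 / (C : ℝ) ^ 2 *
          ((2 / k : ℝ) * (4 + 2 / k) * ∑ j, ∑ l, SFc j l ^ 2) := by
      rw [Finset.sum_const, Finset.card_univ, Fintype.card_prod, Fintype.card_fin, nsmul_eq_mul]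
      push_cast
      field_simp
    rw [hcst, ← Finset.sum_add_distrib, ← Finset.sum_add_distrib]
    refine Finset.sum_congr rfl fun x _ => ?_
    rw [(hcm x.1 x.2).2.2.2]
    ring
  have hfin := second_moment_bound P (fun ω => h (T ω)) M1.1 M2.1 (2 * SF.trace)
    (8 * (1 + 1 / (k : ℝ)) ^ 2 * (SFc ^ 2).trace
            + 16 * (1 + 1 / (k : ℝ)) * (SF * SFc).trace
            + ∫ ω, ((mv (a ω) - mv (b ω)) ⬝ᵥ (Fᵀ * F).mulVec (mv (a ω) - mv (b ω))) ^ 2 ∂P)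
    hE1 (by
      rw [hE2, hl]
      have hp : (0 : ℝ) ≤ 1 / k := by positivity
      have e1 : (2 / k : ℝ) = 2 * (1 / k) := by ring
      have e2 : (4 / k : ℝ) = 4 * (1 / k) := by ring
      rw [e1, e2]
      generalize (1 / k : ℝ) = r at hp
      have a1 : 2 * r * (4 + 2 * r) * (SFc ^ 2).trace ≤ 8 * (1 + r) ^ 2 * (SFc ^ 2).trace :=
        mul_le_mul_of_nonneg_right (by nlinarith) hnn2
      have a2 : (4 + 4 * r) * (2 * (SF * SFc).trace) ≤ 16 * (1 + r) * (SF * SFc).trace := by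
        nlinarith [mul_nonneg hp hnn1]
      linarith) (by positivity)
  rw [hαT]
  have e4 : (2 * SF.trace) ^ 2 = 4 * SF.trace ^ 2 := by ring
  rw [e4] at hfin
  exact hfin
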